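/- arXiv:2402.00314 — 2 statements merged into one kernel-verified Lean document; each statement's English description precedes it below -/
import Mathlib

section
/- Let (a_n)_{n≥0} be a sequence of nonnegative reals, q > 0, α > -1. Then ∫_0^1 (∑_{n=0}^∞ a_n² r^{2^{n+1}})^{q/2} (1-r)^α dr < ∞ if and only if ∑_{n=0}^∞ 2^{-(α+1)n} a_n^q < ∞. Moreover, the two quantities are comparable with constants depending only on q and α. -/
open MeasureTheory
open scoped ENNReal NNReal

lemma mp_gammaL (s δ : ℝ) (hs : 0 < s) (hδ : 0 < δ) :
    ∫⁻ x in Set.Ioi (0 : ℝ), ENNReal.ofReal (x ^ (δ - 1) * Real.exp (-(s * x)))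
      = ENNReal.ofReal ((1 / s) ^ δ * Real.Gamma δ) := by
  have h := Real.integral_rpow_mul_exp_neg_mul_Ioi hδ hs
  have hpos : 0 < (1 / s) ^ δ * Real.Gamma δ :=
    mul_pos (Real.rpow_pos_of_pos (by positivity) _) (Real.Gamma_pos_of_pos hδ)
  rw [← h, ofReal_integral_eq_lintegral_ofReal]
  · by_contra hc
    rw [integral_undef hc] at h
    exact hpos.ne h
  · filter_upwards [ae_restrict_mem measurableSet_Ioi] with x hx
    have hx' : (0 : ℝ) < x := hx
    positivity

lemma mp_rpow_le_exp (r : ℝ) (hr : r ∈ Set.Ioo (0 : ℝ) 1) (n : ℕ) :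
    r ^ (2 ^ n) ≤ Real.exp (-((2 : ℝ) ^ n * (1 - r))) := by
  have h1 : r ≤ Real.exp (-(1 - r)) := by
    have := Real.add_one_le_exp (-(1 - r)); linarith
  calc r ^ (2 ^ n) ≤ Real.exp (-(1 - r)) ^ (2 ^ n) := pow_le_pow_left₀ hr.1.le h1 _
    _ = _ := by
      rw [← Real.exp_nat_mul]; congr 1; push_cast; ring

lemma mp_piece (γ t : ℝ) (hγ : 0 < γ) (ht : 0 < t) (n : ℕ) :
    ENNReal.ofReal ((2 : ℝ) ^ (n * γ) * Real.exp (-((2 : ℝ) ^ n * t))) ≤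
      ENNReal.ofReal (2 * 2 ^ γ) *
      ∫⁻ x in Set.Ioc ((2 : ℝ) ^ n / 2) (2 ^ n),
        ENNReal.ofReal (x ^ (γ - 1) * Real.exp (-(t * x))) := by
  have hN : (0 : ℝ) < 2 ^ n := by positivity
  have key : ENNReal.ofReal (((2 : ℝ) ^ n / 2) ^ γ / 2 ^ n * Real.exp (-((2 : ℝ) ^ n * t))) *
      volume (Set.Ioc ((2 : ℝ) ^ n / 2) (2 ^ n)) ≤
      ∫⁻ x in Set.Ioc ((2 : ℝ) ^ n / 2) (2 ^ n),
        ENNReal.ofReal (x ^ (γ - 1) * Real.exp (-(t * x))) := by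
    rw [← setLIntegral_const]
    apply setLIntegral_mono' measurableSet_Ioc
    intro x hx
    have hx0 : 0 < x := lt_trans (by positivity) hx.1
    apply ENNReal.ofReal_le_ofReal
    rw [Real.rpow_sub_one hx0.ne']
    have h1 : ((2 : ℝ) ^ n / 2) ^ γ ≤ x ^ γ :=
      Real.rpow_le_rpow (by positivity) hx.1.le hγ.le
    have h2 := hx.2
    have h3 : Real.exp (-((2 : ℝ) ^ n * t)) ≤ Real.exp (-(t * x)) := by
      apply Real.exp_le_exp.2; nlinarith
    gcongr
  refine le_trans (le_of_eq ?_) (mul_le_mul_right key _)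
  rw [Real.volume_Ioc, ← ENNReal.ofReal_mul (by positivity), ← ENNReal.ofReal_mul (by positivity)]
  congr 1
  rw [Real.div_rpow hN.le (by norm_num), ← Real.rpow_natCast, ← Real.rpow_mul (by norm_num)]
  have : (0:ℝ) < 2 ^ γ := by positivity
  have : (0:ℝ) < 2 ^ (n:ℝ) := by positivity
  field_simp
  ring

lemma mp_sum (γ t : ℝ) (hγ : 0 < γ) (ht : 0 < t) :
    ∑' n : ℕ, ENNReal.ofReal ((2 : ℝ) ^ (n * γ) * Real.exp (-((2 : ℝ) ^ n * t))) ≤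
      ENNReal.ofReal (2 * 2 ^ γ * Real.Gamma γ * t ^ (-γ)) := by
  have hG := Real.Gamma_pos_of_pos hγ
  calc _ ≤ ∑' n : ℕ, ENNReal.ofReal (2 * 2 ^ γ) *
      ∫⁻ x in Set.Ioc ((2 : ℝ) ^ n / 2) (2 ^ n),
        ENNReal.ofReal (x ^ (γ - 1) * Real.exp (-(t * x))) :=
        ENNReal.tsum_le_tsum (mp_piece γ t hγ ht)
    _ = ENNReal.ofReal (2 * 2 ^ γ) * ∫⁻ x in ⋃ n : ℕ, Set.Ioc ((2 : ℝ) ^ n / 2) (2 ^ n),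
        ENNReal.ofReal (x ^ (γ - 1) * Real.exp (-(t * x))) := by
        rw [ENNReal.tsum_mul_left, lintegral_iUnion (fun _ => measurableSet_Ioc)]
        apply (pairwise_disjoint_on _).2
        intro m n hmn
        rw [Set.disjoint_left]
        intro x hx hy
        have : (2:ℝ) ^ (m+1) ≤ 2 ^ n := pow_le_pow_right₀ (by norm_num) hmn
        rw [pow_succ] at this
        linarith [hx.2, hy.1]
    _ ≤ ENNReal.ofReal (2 * 2 ^ γ) * ∫⁻ x in Set.Ioi (0 : ℝ),
        ENNReal.ofReal (x ^ (γ - 1) * Real.exp (-(t * x))) := by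
        gcongr
        apply Set.iUnion_subset
        intro n x hx
        exact lt_trans (by positivity) hx.1
    _ = _ := by
        rw [mp_gammaL t γ ht hγ, ← ENNReal.ofReal_mul (by positivity), one_div,
          Real.inv_rpow ht.le, Real.rpow_neg ht.le]
        congr 1; ring

lemma mp_rpow_sq (x : ℝ≥0∞) (q : ℝ) : (x ^ 2) ^ (q / 2) = x ^ q := by
  rw [← ENNReal.rpow_natCast, ← ENNReal.rpow_mul]
  congr 1; push_cast; ring

lemma mp_pointwise (q γ : ℝ) (hq : 0 < q) (hγ : 0 < γ) (a : ℕ → ℝ≥0) (r : ℝ)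
    (hr : r ∈ Set.Ioo (0 : ℝ) 1) :
    (∑' n : ℕ, (a n : ℝ≥0∞) ^ 2 * ENNReal.ofReal r ^ (2 ^ (n + 1))) ^ (q / 2) ≤
      ENNReal.ofReal ((2 * 2 ^ γ * Real.Gamma γ) ^ (q / 2)) *
      ∑' n : ℕ, (a n : ℝ≥0∞) ^ q * ENNReal.ofReal ((2 : ℝ) ^ (-(n * γ * (q / 2))) *
        (Real.exp (-((q / 2 * 2 ^ n) * (1 - r))) * (1 - r) ^ (-(γ * (q / 2))))) := by
  have hp : 0 < q / 2 := by positivity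
  have ht : 0 < 1 - r := by linarith [hr.2]
  have hG := Real.Gamma_pos_of_pos hγ
  set t := 1 - r with htdef
  set u : ℕ → ℝ≥0∞ := fun n => (a n : ℝ≥0∞) ^ 2 *
    ENNReal.ofReal ((2 : ℝ) ^ (-(n * γ)) * Real.exp (-((2 : ℝ) ^ n * t))) with hu
  set v : ℕ → ℝ≥0∞ := fun n =>
    ENNReal.ofReal ((2 : ℝ) ^ (n * γ) * Real.exp (-((2 : ℝ) ^ n * t))) with hv
  have h1 : ∀ n : ℕ, (a n : ℝ≥0∞) ^ 2 * ENNReal.ofReal r ^ (2 ^ (n + 1)) ≤ u n * v n := by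
    intro n
    simp only [hu, hv]
    rw [mul_assoc, ← ENNReal.ofReal_mul (by positivity), ← ENNReal.ofReal_pow hr.1.le]
    gcongr
    have h2 := mp_rpow_le_exp r hr n
    have h3 : (2 : ℝ) ^ (-(n * γ)) * (2 : ℝ) ^ (n * γ) = 1 := by
      rw [← Real.rpow_add (by norm_num)]; simp
    calc r ^ (2 ^ (n + 1)) = r ^ (2 ^ n) * r ^ (2 ^ n) := by
          rw [← pow_add]; congr 1; ring
      _ ≤ Real.exp (-((2 : ℝ) ^ n * t)) * Real.exp (-((2 : ℝ) ^ n * t)) := by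
          have := pow_nonneg hr.1.le (2 ^ n)
          gcongr
      _ = ((2 : ℝ) ^ (-(n * γ)) * (2 : ℝ) ^ (n * γ)) *
          (Real.exp (-((2 : ℝ) ^ n * t)) * Real.exp (-((2 : ℝ) ^ n * t))) := by rw [h3, one_mul]
      _ = _ := by ring
  have h2 : ∀ n, u n ≤ (∑' m, u m ^ (q / 2)) ^ (1 / (q / 2)) := by
    intro n
    calc u n = (u n ^ (q / 2)) ^ (1 / (q / 2)) := by
          rw [← ENNReal.rpow_mul, mul_one_div_cancel hp.ne', ENNReal.rpow_one]
      _ ≤ _ := by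
          gcongr
          exact ENNReal.le_tsum n
  have h3 : ∑' n : ℕ, (a n : ℝ≥0∞) ^ 2 * ENNReal.ofReal r ^ (2 ^ (n + 1)) ≤
      (∑' m, u m ^ (q / 2)) ^ (1 / (q / 2)) *
        ENNReal.ofReal (2 * 2 ^ γ * Real.Gamma γ * t ^ (-γ)) := by
    calc _ ≤ ∑' n, (∑' m, u m ^ (q / 2)) ^ (1 / (q / 2)) * v n :=
          ENNReal.tsum_le_tsum fun n => (h1 n).trans (by gcongr; exact h2 n)
      _ = (∑' m, u m ^ (q / 2)) ^ (1 / (q / 2)) * ∑' n, v n := ENNReal.tsum_mul_left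
      _ ≤ _ := by gcongr; exact mp_sum γ t hγ ht
  calc _ ≤ ((∑' m, u m ^ (q / 2)) ^ (1 / (q / 2)) *
        ENNReal.ofReal (2 * 2 ^ γ * Real.Gamma γ * t ^ (-γ))) ^ (q / 2) := by gcongr
    _ = (∑' m, u m ^ (q / 2)) *
        ENNReal.ofReal ((2 * 2 ^ γ * Real.Gamma γ) ^ (q / 2) * t ^ (-(γ * (q / 2)))) := by
        rw [ENNReal.mul_rpow_of_nonneg _ _ hp.le, ← ENNReal.rpow_mul,
          one_div_mul_cancel hp.ne', ENNReal.rpow_one,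
          ENNReal.ofReal_rpow_of_nonneg (by positivity) hp.le,
          Real.mul_rpow (by positivity) (by positivity), ← Real.rpow_mul ht.le, neg_mul]
    _ = _ := by
        rw [ENNReal.ofReal_mul (by positivity), mul_left_comm, ← ENNReal.tsum_mul_right]
        congr 1
        apply tsum_congr
        intro n
        simp only [hu]
        rw [ENNReal.mul_rpow_of_nonneg _ _ hp.le, mp_rpow_sq,
          ENNReal.ofReal_rpow_of_nonneg (by positivity) hp.le, mul_assoc,
          ← ENNReal.ofReal_mul (by positivity),
          Real.mul_rpow (by positivity) (by positivity), ← Real.rpow_mul (by positivity),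
          ← Real.exp_mul, mul_assoc]
        congr 5
        · ring
        · ring

lemma mp_int (s δ : ℝ) (hs : 0 < s) (hδ : 0 < δ) :
    ∫⁻ r in Set.Ioo (0 : ℝ) 1,
      ENNReal.ofReal ((1 - r) ^ (δ - 1) * Real.exp (-(s * (1 - r))))
      ≤ ENNReal.ofReal ((1 / s) ^ δ * Real.Gamma δ) := by
  rw [← mp_gammaL s δ hs hδ, ← lintegral_indicator measurableSet_Ioo,
    ← lintegral_indicator measurableSet_Ioi,
    ← lintegral_sub_left_eq_self _ (1 : ℝ)]
  apply lintegral_mono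
  intro r
  by_cases h : 1 - r ∈ Set.Ioo (0 : ℝ) 1
  · have h' : r ∈ Set.Ioi (0 : ℝ) := by
      have := h.2; simp only [Set.mem_Ioi]; linarith
    simp only [Set.indicator_of_mem h, Set.indicator_of_mem h']
    simp
  · simp only [Set.indicator_of_notMem h]
    exact zero_le

lemma mp_upper (q α : ℝ) (hq : 0 < q) (hα : -1 < α) :
    ∃ C : ℝ≥0, 0 < C ∧ ∀ a : ℕ → ℝ≥0,
      ((∫⁻ r in Set.Ioo (0 : ℝ) 1,
          (∑' n : ℕ, (a n : ℝ≥0∞) ^ 2 * ENNReal.ofReal r ^ (2 ^ (n + 1))) ^ (q / 2) *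
            ENNReal.ofReal ((1 - r) ^ α)) ≤
        (C : ℝ≥0∞) *
          ∑' n : ℕ, ENNReal.ofReal ((2 : ℝ) ^ (-(α + 1) * n)) * (a n : ℝ≥0∞) ^ (q : ℝ)) := by
  have hβ : 0 < α + 1 := by linarith
  set δ := (α + 1) / 2 with hδd
  have hδ : 0 < δ := by positivity
  set γ := (α + 1) / q with hγd
  have hγ : 0 < γ := by positivity
  have hγq : γ * (q / 2) = δ := by simp only [hγd, hδd]; field_simp
  have hG := Real.Gamma_pos_of_pos hγ
  have hG2 := Real.Gamma_pos_of_pos hδ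
  set K := (2 * 2 ^ γ * Real.Gamma γ) ^ (q / 2) with hK
  have hKpos : 0 < K := by positivity
  set L := (1 / (q / 2)) ^ δ * Real.Gamma δ with hL
  have hLpos : 0 < L := by positivity
  refine ⟨Real.toNNReal (K * L), by simpa using mul_pos hKpos hLpos, fun a => ?_⟩
  calc _ ≤ ∫⁻ r in Set.Ioo (0 : ℝ) 1, ENNReal.ofReal K * ∑' n : ℕ, (a n : ℝ≥0∞) ^ q *
        ENNReal.ofReal ((2 : ℝ) ^ (-(n * δ))) *
        ENNReal.ofReal ((1 - r) ^ (δ - 1) * Real.exp (-((q / 2 * 2 ^ n) * (1 - r)))) := by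
        apply setLIntegral_mono' measurableSet_Ioo
        intro r hr
        have ht : 0 < 1 - r := by linarith [hr.2]
        refine (mul_le_mul_left (mp_pointwise q γ hq hγ a r hr) _).trans (le_of_eq ?_)
        rw [mul_assoc, ← ENNReal.tsum_mul_right]
        congr 1
        apply tsum_congr
        intro n
        rw [mul_assoc, ← ENNReal.ofReal_mul (by positivity), mul_assoc ((a n : ℝ≥0∞) ^ q),
          ← ENNReal.ofReal_mul (by positivity), mul_assoc (n : ℝ), hγq]
        congr 2
        have : (1 - r) ^ (δ - 1) = (1 - r) ^ (-δ) * (1 - r) ^ α := by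
          rw [← Real.rpow_add ht]; congr 1; simp only [hδd]; ring
        rw [this]; ring
    _ = ENNReal.ofReal K * ∑' n : ℕ, (a n : ℝ≥0∞) ^ q *
        ENNReal.ofReal ((2 : ℝ) ^ (-(n * δ))) *
        ∫⁻ r in Set.Ioo (0 : ℝ) 1,
        ENNReal.ofReal ((1 - r) ^ (δ - 1) * Real.exp (-((q / 2 * 2 ^ n) * (1 - r)))) := by
        rw [lintegral_const_mul _ (by fun_prop), lintegral_tsum (fun n => by fun_prop)]
        congr 1
        apply tsum_congr
        intro n
        rw [lintegral_const_mul _ (by fun_prop)]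
    _ ≤ ENNReal.ofReal K * ∑' n : ℕ, (a n : ℝ≥0∞) ^ q *
        ENNReal.ofReal ((2 : ℝ) ^ (-(n * δ))) *
        ENNReal.ofReal ((1 / (q / 2 * 2 ^ n)) ^ δ * Real.Gamma δ) := by
        gcongr with n
        exact mp_int _ _ (by positivity) hδ
    _ = _ := by
        change _ = ENNReal.ofReal (K * L) * _
        rw [ENNReal.ofReal_mul hKpos.le, mul_assoc, ← ENNReal.tsum_mul_left (a := ENNReal.ofReal L)]
        congr 1
        apply tsum_congr
        intro n
        rw [mul_assoc, ← ENNReal.ofReal_mul (by positivity), ← mul_assoc (ENNReal.ofReal L),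
          ← ENNReal.ofReal_mul hLpos.le, mul_comm]
        congr 2
        have e1 : (1 / (q / 2 * 2 ^ n)) ^ δ = (1 / (q / 2)) ^ δ * (2:ℝ) ^ (-(n * δ)) := by
          rw [one_div, mul_inv, Real.mul_rpow (by positivity) (by positivity), one_div,
            ← Real.rpow_natCast, ← Real.rpow_neg (by norm_num), ← Real.rpow_mul (by norm_num),
            neg_mul]
        have e2 : (2:ℝ) ^ (-(α + 1) * n) = (2:ℝ) ^ (-(n * δ)) * (2:ℝ) ^ (-(n * δ)) := by
          rw [← Real.rpow_add (by norm_num)]; congr 1; simp only [hδd]; ring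
        rw [e1, e2]; ring

lemma mp_lower_piece (q α : ℝ) (hq : 0 < q) (hα : -1 < α) (a : ℕ → ℝ≥0) (n : ℕ) :
    ENNReal.ofReal ((1 / 4) ^ (q / 2) * (1 / 4) ^ (α + 1) / 2) *
      (ENNReal.ofReal ((2 : ℝ) ^ (-(α + 1) * n)) * (a n : ℝ≥0∞) ^ (q : ℝ)) ≤
    ∫⁻ r in Set.Ioo (1 - 1 / (2 : ℝ) ^ (n + 1)) (1 - 1 / (2 : ℝ) ^ (n + 2)),
          (∑' n : ℕ, (a n : ℝ≥0∞) ^ 2 * ENNReal.ofReal r ^ (2 ^ (n + 1))) ^ (q / 2) *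
            ENNReal.ofReal ((1 - r) ^ α) := by
  have hβ : 0 < α + 1 := by linarith
  have hp : 0 < q / 2 := by positivity
  have hN1 : 1 / (2 : ℝ) ^ (n + 1) ≤ 1 / 2 := by
    rw [pow_succ]
    have : (1:ℝ) ≤ 2 ^ n := one_le_pow₀ (by norm_num)
    apply one_div_le_one_div_of_le <;> linarith
  have key : ((a n : ℝ≥0∞) ^ (q : ℝ) * ENNReal.ofReal ((1 / 4) ^ (q / 2)) *
      ENNReal.ofReal ((1 / (2 : ℝ) ^ (n + 2)) ^ (α + 1) * 2 ^ (n + 1))) *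
      volume (Set.Ioo (1 - 1 / (2 : ℝ) ^ (n + 1)) (1 - 1 / (2 : ℝ) ^ (n + 2))) ≤
    ∫⁻ r in Set.Ioo (1 - 1 / (2 : ℝ) ^ (n + 1)) (1 - 1 / (2 : ℝ) ^ (n + 2)),
          (∑' n : ℕ, (a n : ℝ≥0∞) ^ 2 * ENNReal.ofReal r ^ (2 ^ (n + 1))) ^ (q / 2) *
            ENNReal.ofReal ((1 - r) ^ α) := by
    rw [← setLIntegral_const]
    apply setLIntegral_mono' measurableSet_Ioo
    intro r hr
    have hr0 : 0 < r := by linarith [hr.1]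
    have ht1 : 1 / (2 : ℝ) ^ (n + 2) < 1 - r := by linarith [hr.2]
    have ht2 : 1 - r < 1 / (2 : ℝ) ^ (n + 1) := by linarith [hr.1]
    have ht : 0 < 1 - r := lt_trans (by positivity) ht1
    gcongr ?_ * ?_
    · have h1 : (1 / 4 : ℝ) ≤ r ^ (2 ^ (n + 1)) := by
        have hb := one_add_mul_le_pow (a := -(1 - r)) (by linarith) (2 ^ n)
        have e : 1 + -(1 - r) = r := by ring
        rw [e] at hb
        push_cast at hb
        have h3 : (2:ℝ) ^ n * (1 - r) ≤ 1 / 2 := by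
          calc (2:ℝ) ^ n * (1 - r) ≤ 2 ^ n * (1 / 2 ^ (n + 1)) := by gcongr
            _ = 1 / 2 := by rw [pow_succ]; field_simp
        have h4 : 1 / 2 ≤ r ^ (2 ^ n) := by linarith
        rw [pow_succ 2 n, pow_mul]
        nlinarith
      calc (a n : ℝ≥0∞) ^ q * ENNReal.ofReal ((1 / 4) ^ (q / 2))
          = ((a n : ℝ≥0∞) ^ 2 * ENNReal.ofReal (1 / 4)) ^ (q / 2) := by
            rw [ENNReal.mul_rpow_of_nonneg _ _ hp.le, mp_rpow_sq,
              ENNReal.ofReal_rpow_of_nonneg (by positivity) hp.le]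
        _ ≤ ((a n : ℝ≥0∞) ^ 2 * ENNReal.ofReal r ^ (2 ^ (n + 1))) ^ (q / 2) := by
            rw [← ENNReal.ofReal_pow hr0.le]
            gcongr
        _ ≤ _ := by
            gcongr
            exact ENNReal.le_tsum (f := fun n =>
              (a n : ℝ≥0∞) ^ 2 * ENNReal.ofReal r ^ (2 ^ (n + 1))) n
    · apply ENNReal.ofReal_le_ofReal
      have e : (1 - r) ^ α = (1 - r) ^ (α + 1) * (1 - r)⁻¹ := by
        rw [Real.rpow_add_one ht.ne']; field_simp
      rw [e]
      have h5 : (2 : ℝ) ^ (n + 1) ≤ (1 - r)⁻¹ := by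
        rw [le_inv_comm₀ (by positivity) ht, ← one_div]; exact ht2.le
      gcongr
  refine le_trans (le_of_eq ?_) key
  rw [Real.volume_Ioo, mul_assoc, mul_assoc, ← ENNReal.ofReal_mul (by positivity),
    ← ENNReal.ofReal_mul (by positivity), ← mul_assoc, ← ENNReal.ofReal_mul (by positivity),
    mul_comm]
  congr 2
  have e1 : (1 / (2 : ℝ) ^ (n + 2)) ^ (α + 1) =
      (2:ℝ) ^ (-(α + 1) * n) * (1 / 4) ^ (α + 1) := by
    rw [pow_add, one_div, mul_inv, Real.mul_rpow (by positivity) (by positivity),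
      ← Real.rpow_natCast 2 n, ← Real.rpow_neg (by norm_num), ← Real.rpow_mul (by norm_num)]
    norm_num
    left; congr 1; ring
  rw [e1]
  have e2 : (2:ℝ) ^ (n + 1) * (1 - 1 / 2 ^ (n + 2) - (1 - 1 / 2 ^ (n + 1))) = 1 / 2 := by
    rw [pow_succ, pow_add]; field_simp; ring
  rw [mul_assoc (_ * _) _ (_ - _), e2]
  ring

lemma mp_lower (q α : ℝ) (hq : 0 < q) (hα : -1 < α) (a : ℕ → ℝ≥0) :
    ENNReal.ofReal ((1 / 4) ^ (q / 2) * (1 / 4) ^ (α + 1) / 2) *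
      ∑' n : ℕ, ENNReal.ofReal ((2 : ℝ) ^ (-(α + 1) * n)) * (a n : ℝ≥0∞) ^ (q : ℝ) ≤
    ∫⁻ r in Set.Ioo (0 : ℝ) 1,
          (∑' n : ℕ, (a n : ℝ≥0∞) ^ 2 * ENNReal.ofReal r ^ (2 ^ (n + 1))) ^ (q / 2) *
            ENNReal.ofReal ((1 - r) ^ α) := by
  rw [← ENNReal.tsum_mul_left]
  refine (ENNReal.tsum_le_tsum (mp_lower_piece q α hq hα a)).trans ?_
  rw [← lintegral_iUnion (fun _ => measurableSet_Ioo)]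
  · apply lintegral_mono_set
    apply Set.iUnion_subset
    intro n x hx
    have h1 : 0 < 1 / (2:ℝ) ^ (n + 2) := by positivity
    have h2 : 1 / (2:ℝ) ^ (n + 1) ≤ 1 := by
      rw [div_le_one (by positivity)]; exact one_le_pow₀ (by norm_num)
    exact ⟨by linarith [hx.1], by linarith [hx.2]⟩
  · apply (pairwise_disjoint_on _).2
    intro m n hmn
    rw [Set.disjoint_left]
    intro x hx hy
    have : 1 / (2:ℝ) ^ (n + 1) ≤ 1 / 2 ^ (m + 2) := by
      apply one_div_le_one_div_of_le (by positivity)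
      exact pow_le_pow_right₀ (by norm_num) (by omega)
    linarith [hx.2, hy.1]

/-- Mateljević–Pavlović characterization of lacunary series: for nonnegative `(a_n)`,
`q > 0`, `α > -1`, the integral `∫_0^1 (∑ a_n² r^{2^{n+1}})^{q/2} (1-r)^α dr` is
comparable, with constants depending only on `q` and `α`, to
`∑ 2^{-(α+1)n} a_n^q`; in particular one is finite iff the other is. -/
theorem mateljevic_pavlovic (q α : ℝ) (hq : 0 < q) (hα : -1 < α) :
    ∃ c C : ℝ≥0, 0 < c ∧ 0 < C ∧ ∀ a : ℕ → ℝ≥0,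
      ((c : ℝ≥0∞) *
          ∑' n : ℕ, ENNReal.ofReal ((2 : ℝ) ^ (-(α + 1) * n)) * (a n : ℝ≥0∞) ^ (q : ℝ) ≤
        ∫⁻ r in Set.Ioo (0 : ℝ) 1,
          (∑' n : ℕ, (a n : ℝ≥0∞) ^ 2 * ENNReal.ofReal r ^ (2 ^ (n + 1))) ^ (q / 2) *
            ENNReal.ofReal ((1 - r) ^ α)) ∧
      ((∫⁻ r in Set.Ioo (0 : ℝ) 1,
          (∑' n : ℕ, (a n : ℝ≥0∞) ^ 2 * ENNReal.ofReal r ^ (2 ^ (n + 1))) ^ (q / 2) *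
            ENNReal.ofReal ((1 - r) ^ α)) ≤
        (C : ℝ≥0∞) *
          ∑' n : ℕ, ENNReal.ofReal ((2 : ℝ) ^ (-(α + 1) * n)) * (a n : ℝ≥0∞) ^ (q : ℝ)) := by
  obtain ⟨C, hC, hU⟩ := mp_upper q α hq hα
  refine ⟨Real.toNNReal ((1 / 4) ^ (q / 2) * (1 / 4) ^ (α + 1) / 2), C, ?_, hC, fun a => ⟨?_, hU a⟩⟩
  · rw [Real.toNNReal_pos]; positivity
  · exact mp_lower q α hq hα a
end

section
/- Let α > -1 and 0 < q < ∞. The lacunary series f(s) = ∑_{n=0}^∞ a_n 2^{-2^n s} satisfies ∫_0^∞ (∑_{n=0}^∞ |a_n|² 2^{-2^{n+1}σ})^{q/2} dμ_α(σ) < ∞ if and only if ∑_{n=0}^∞ 2^{-(α+1)n} |a_n|^q < ∞, where dμ_α(σ) = (2^{α+1}/Γ(α+1)) σ^α e^{-2σ} dσ. -/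
open MeasureTheory
open scoped ENNReal

lemma lac_exp_bound (δ κ : ℝ) (hδ : 0 < δ) (hκ : 0 < κ) :
    ∃ K : ℝ, 0 < K ∧ ∀ t : ℝ, 0 < t → t ^ δ ≤ K * Real.exp (κ * t) := by
  refine ⟨(κ / δ) ^ (-δ), by positivity, fun t ht => ?_⟩
  have h0 : 0 < κ / δ := by positivity
  have h1 : (κ / δ * t) ^ δ ≤ (Real.exp (κ / δ * t)) ^ δ := by
    apply Real.rpow_le_rpow (by positivity) _ hδ.le
    linarith [Real.add_one_le_exp (κ / δ * t)]
  rw [← Real.exp_mul, Real.mul_rpow h0.le ht.le] at h1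
  have h2 : κ / δ * t * δ = κ * t := by field_simp
  rw [h2] at h1
  rw [Real.rpow_neg h0.le]
  have h3 : 0 < (κ / δ) ^ δ := by positivity
  rw [inv_mul_eq_div, le_div_iff₀ h3]
  linarith

/-- the telescoping function -/
noncomputable def lacG (δ t : ℝ) : ℝ := t ^ δ / (1 + t ^ δ)

lemma lac_G_bound (δ κ : ℝ) (hδ : 0 < δ) (hκ : 0 < κ) :
    ∃ C : ℝ, 0 < C ∧ ∀ t : ℝ, 0 < t →
      t ^ δ * Real.exp (-(κ * t)) ≤ C * (lacG δ (2 * t) - lacG δ t) := by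
  obtain ⟨K, hK, h⟩ := lac_exp_bound δ (κ / 2) hδ (by positivity)
  set A : ℝ := 2 ^ δ with hA
  have hA1 : 1 < A := Real.one_lt_rpow (by norm_num) hδ
  have hA0 : 0 < A - 1 := by linarith
  refine ⟨(1 + A * K) ^ 2 / (A - 1), by positivity, fun t ht => ?_⟩
  have hu : 0 < t ^ δ := by positivity
  have hE : 1 ≤ Real.exp (κ / 2 * t) := Real.one_le_exp (by positivity)
  have hk := h t ht
  have hEE : Real.exp (κ * t) = Real.exp (κ / 2 * t) ^ 2 := by
    rw [← Real.exp_nat_mul]; congr 1; push_cast; ring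
  rw [Real.exp_neg, hEE]
  unfold lacG
  rw [Real.mul_rpow (by norm_num) ht.le, ← hA]
  set u := t ^ δ
  set E := Real.exp (κ / 2 * t)
  have hE0 : 0 < E := by linarith
  have e1 : (1 + A * K) ^ 2 / (A - 1) * (A * u / (1 + A * u) - u / (1 + u))
      = (1 + A * K) ^ 2 * u / ((1 + A * u) * (1 + u)) := by
    have : (1 + A * u) ≠ 0 := by positivity
    have : (1 + u) ≠ 0 := by positivity
    field_simp
    ring
  rw [e1, ← div_eq_mul_inv, div_le_div_iff₀ (by positivity) (by positivity)]
  have f1 : 1 + A * u ≤ (1 + A * K) * E := by nlinarith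
  have f2 : 1 + u ≤ (1 + A * K) * E := by nlinarith
  have f3 : (1 + A * u) * (1 + u) ≤ ((1 + A * K) * E) * ((1 + A * K) * E) :=
    mul_le_mul f1 f2 (by positivity) (by positivity)
  calc u * ((1 + A * u) * (1 + u)) ≤ u * (((1 + A * K) * E) * ((1 + A * K) * E)) := by gcongr
    _ = _ := by ring

lemma lacG_nonneg (δ t : ℝ) (ht : 0 < t) : 0 ≤ lacG δ t := by
  unfold lacG; positivity

lemma lacG_le_one (δ t : ℝ) (ht : 0 < t) : lacG δ t ≤ 1 := by
  unfold lacG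
  have : 0 < t ^ δ := by positivity
  rw [div_le_one (by positivity)]; linarith

lemma lacG_mono (δ t : ℝ) (hδ : 0 < δ) (ht : 0 < t) : 0 ≤ lacG δ (2 * t) - lacG δ t := by
  unfold lacG
  have h0 : 0 < t ^ δ := by positivity
  have h1 : t ^ δ ≤ (2 * t) ^ δ := Real.rpow_le_rpow ht.le (by linarith) hδ.le
  rw [sub_nonneg, div_le_div_iff₀ (by positivity) (by positivity)]
  nlinarith

lemma lac_tsum_w (δ σ : ℝ) (hδ : 0 < δ) (hσ : 0 < σ) :
    ∑' n : ℕ, ENNReal.ofReal (lacG δ (2 * (2 ^ n * σ)) - lacG δ (2 ^ n * σ)) ≤ 1 := by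
  rw [ENNReal.tsum_eq_iSup_nat]
  refine iSup_le fun N => ?_
  rw [← ENNReal.ofReal_sum_of_nonneg (fun n _ => lacG_mono δ _ hδ (by positivity))]
  rw [← ENNReal.ofReal_one]
  apply ENNReal.ofReal_le_ofReal
  have : ∀ n : ℕ, lacG δ (2 * (2 ^ n * σ)) - lacG δ (2 ^ n * σ)
      = lacG δ (2 ^ (n + 1) * σ) - lacG δ (2 ^ n * σ) := by
    intro n; rw [pow_succ]; congr 2; ring
  simp_rw [this]
  rw [Finset.sum_range_sub (fun n => lacG δ (2 ^ n * σ))]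
  have := lacG_le_one δ (2 ^ N * σ) (by positivity)
  have := lacG_nonneg δ (2 ^ 0 * σ) (by positivity)
  linarith

lemma lac_sup (p : ℝ) (hp : 0 < p) (y w : ℕ → ℝ≥0∞) (hw : ∑' n, w n ≤ 1) :
    (∑' n, y n * w n) ^ p ≤ ∑' n, y n ^ p := by
  have h : ∑' n, y n * w n ≤ (∑' n, y n ^ p) ^ p⁻¹ := by
    calc ∑' n, y n * w n ≤ ∑' n, (∑' n, y n ^ p) ^ p⁻¹ * w n := by
          refine ENNReal.tsum_le_tsum fun n => ?_
          gcongr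
          rw [ENNReal.le_rpow_inv_iff hp]
          exact ENNReal.le_tsum n
      _ = (∑' n, y n ^ p) ^ p⁻¹ * ∑' n, w n := ENNReal.tsum_mul_left
      _ ≤ (∑' n, y n ^ p) ^ p⁻¹ * 1 := by gcongr
      _ = _ := mul_one _
  exact (ENNReal.le_rpow_inv_iff hp).1 h

lemma lac_pow_eq (n : ℕ) (σ : ℝ) : (2 : ℝ) ^ (-((2 : ℝ) ^ (n + 1)) * σ)
    = Real.exp (-(Real.log 2 * (2 ^ n * σ))) * Real.exp (-(Real.log 2 * (2 ^ n * σ))) := by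
  rw [Real.rpow_def_of_pos (by norm_num), ← Real.exp_add]
  congr 1; rw [pow_succ]; ring

lemma lac_gamma_lintegral (s r : ℝ) (hs : 0 < s) (hr : 0 < r) :
    ∫⁻ σ in Set.Ioi (0 : ℝ), ENNReal.ofReal (σ ^ (s - 1) * Real.exp (-(r * σ)))
      = ENNReal.ofReal ((1 / r) ^ s * Real.Gamma s) := by
  have h := Real.integral_rpow_mul_exp_neg_mul_Ioi hs hr
  rw [← h, ofReal_integral_eq_lintegral_ofReal]
  · apply Integrable.of_integral_ne_zero
    rw [h]
    have := Real.Gamma_pos_of_pos hs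
    positivity
  · filter_upwards [ae_restrict_mem measurableSet_Ioi] with σ hσ
    have : (0 : ℝ) < σ := hσ
    positivity

/-- pointwise upper estimate -/
lemma lac_pointwise (q α : ℝ) (hq : 0 < q) (hα : -1 < α) (a : ℕ → ℂ) :
    ∃ C : ℝ, 0 < C ∧ ∀ σ : ℝ, 0 < σ →
    (∑' n : ℕ, ENNReal.ofReal (‖a n‖ ^ 2 * (2 : ℝ) ^ (-((2 : ℝ) ^ (n + 1)) * σ))) ^ (q / 2) *
          ENNReal.ofReal ((2 ^ (α + 1) / Real.Gamma (α + 1)) * σ ^ α * Real.exp (-2 * σ)) ≤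
    ∑' n : ℕ, ENNReal.ofReal (C * (‖a n‖ ^ q * (2 : ℝ) ^ (-((α + 1) / 2) * n))) *
      ENNReal.ofReal (σ ^ ((α + 1) / 2 - 1) *
        Real.exp (-((q / 2 * Real.log 2 * 2 ^ n) * σ))) := by
  have hα1 : 0 < α + 1 := by linarith
  have hl : 0 < Real.log 2 := Real.log_pos (by norm_num)
  set δ := (α + 1) / q with hδd
  have hδ : 0 < δ := by positivity
  have hΓ : 0 < Real.Gamma (α + 1) := Real.Gamma_pos_of_pos hα1
  obtain ⟨C, hC, hb⟩ := lac_G_bound δ (Real.log 2) hδ hl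
  set D : ℝ := 2 ^ (α + 1) / Real.Gamma (α + 1) with hD
  have hD0 : 0 < D := by positivity
  refine ⟨C ^ (q / 2) * D, by positivity, fun σ hσ => ?_⟩
  have key : ∑' n : ℕ, ENNReal.ofReal (‖a n‖ ^ 2 * (2 : ℝ) ^ (-((2 : ℝ) ^ (n + 1)) * σ)) ≤
      ∑' n : ℕ, ENNReal.ofReal (C * (‖a n‖ ^ 2 * (2 ^ n * σ) ^ (-δ) *
        Real.exp (-(Real.log 2 * (2 ^ n * σ))))) *
        ENNReal.ofReal (lacG δ (2 * (2 ^ n * σ)) - lacG δ (2 ^ n * σ)) := by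
    refine ENNReal.tsum_le_tsum fun n => ?_
    rw [← ENNReal.ofReal_mul (by positivity)]
    apply ENNReal.ofReal_le_ofReal
    rw [lac_pow_eq]
    have ht : 0 < 2 ^ n * σ := by positivity
    have hh := hb _ ht
    set t := 2 ^ n * σ
    set E := Real.exp (-(Real.log 2 * t))
    have hE : 0 < E := Real.exp_pos _
    have hu : t ^ (-δ) * t ^ δ = 1 := by
      rw [← Real.rpow_add ht]; simp
    calc ‖a n‖ ^ 2 * (E * E) = (‖a n‖ ^ 2 * t ^ (-δ) * E) * (t ^ δ * E) := by
          linear_combination (-(‖a n‖ ^ 2 * E * E)) * hu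
      _ ≤ (‖a n‖ ^ 2 * t ^ (-δ) * E) * (C * (lacG δ (2 * t) - lacG δ t)) := by gcongr
      _ = _ := by ring
  have hp : 0 < q / 2 := by positivity
  have key2 := (ENNReal.rpow_le_rpow key hp.le).trans
    (lac_sup (q / 2) hp _ _ (lac_tsum_w δ σ hδ hσ))
  refine (mul_le_mul_left key2 _).trans ?_
  rw [← ENNReal.tsum_mul_right]
  refine ENNReal.tsum_le_tsum fun n => ?_
  rw [ENNReal.ofReal_rpow_of_nonneg (by positivity) hp.le, ← ENNReal.ofReal_mul (by positivity),
    ← ENNReal.ofReal_mul (by positivity)]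
  apply ENNReal.ofReal_le_ofReal
  have ht : 0 < (2 : ℝ) ^ n * σ := by positivity
  rw [Real.mul_rpow hC.le (by positivity), Real.mul_rpow (by positivity) (by positivity),
    Real.mul_rpow (by positivity) (by positivity), ← Real.rpow_mul ht.le, ← Real.exp_mul,
    ← Real.rpow_natCast ‖a n‖ 2, ← Real.rpow_mul (norm_nonneg _)]
  have e1 : ((2 : ℕ) : ℝ) * (q / 2) = q := by push_cast; ring
  have e2 : -δ * (q / 2) = -((α + 1) / 2) := by rw [hδd]; field_simp
  have e3 : -(Real.log 2 * (2 ^ n * σ)) * (q / 2) = -((q / 2 * Real.log 2 * 2 ^ n) * σ) := by ring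
  rw [e1, e2, e3, Real.mul_rpow (by positivity) hσ.le, ← Real.rpow_natCast 2 n,
    ← Real.rpow_mul (by norm_num)]
  have e4 : σ ^ ((α + 1) / 2 - 1) = σ ^ (-((α + 1) / 2)) * σ ^ α := by
    rw [← Real.rpow_add hσ]; congr 1; ring
  rw [e4, mul_comm (n : ℝ)]
  have e5 : Real.exp (-2 * σ) ≤ 1 := Real.exp_le_one_iff.2 (by linarith)
  have : 0 ≤ σ ^ α := by positivity
  refine (mul_le_mul_of_nonneg_left (mul_le_mul_of_nonneg_left e5 (by positivity))
    (by positivity)).trans (le_of_eq ?_)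
  ring

lemma lac_lower (q α : ℝ) (hq : 0 < q) (hα : -1 < α) (a : ℕ → ℂ) :
    ∃ c : ℝ, 0 < c ∧ ∀ n : ℕ, ∀ σ ∈ Set.Ioc ((2 : ℝ)⁻¹ ^ (n + 1)) ((2 : ℝ)⁻¹ ^ n),
    ENNReal.ofReal (c * (2 : ℝ) ^ (-α * n) * ‖a n‖ ^ q) ≤
    (∑' n : ℕ, ENNReal.ofReal (‖a n‖ ^ 2 * (2 : ℝ) ^ (-((2 : ℝ) ^ (n + 1)) * σ))) ^ (q / 2) *
          ENNReal.ofReal ((2 ^ (α + 1) / Real.Gamma (α + 1)) * σ ^ α * Real.exp (-2 * σ)) := by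
  have hα1 : 0 < α + 1 := by linarith
  have hΓ : 0 < Real.Gamma (α + 1) := Real.Gamma_pos_of_pos hα1
  set D : ℝ := 2 ^ (α + 1) / Real.Gamma (α + 1) with hD
  have hD0 : 0 < D := by positivity
  have hp : 0 < q / 2 := by positivity
  refine ⟨((2 : ℝ) ^ (-2 : ℝ)) ^ (q / 2) * (D * (2 : ℝ)⁻¹ ^ |α| * Real.exp (-2)),
    by positivity, fun n σ hσ => ?_⟩
  obtain ⟨h1, h2⟩ := hσ
  have hσ0 : 0 < σ := lt_trans (by positivity) h1
  have hinv : (2 : ℝ)⁻¹ ^ n * 2 ^ n = 1 := by rw [← mul_pow]; norm_num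
  have hF : ENNReal.ofReal ((‖a n‖ ^ 2 * (2 : ℝ) ^ (-2 : ℝ)) ^ (q / 2)) ≤
      (∑' n : ℕ, ENNReal.ofReal (‖a n‖ ^ 2 * (2 : ℝ) ^ (-((2 : ℝ) ^ (n + 1)) * σ))) ^ (q / 2) := by
    rw [← ENNReal.ofReal_rpow_of_nonneg (by positivity) hp.le]
    refine ENNReal.rpow_le_rpow ?_ hp.le
    refine le_trans ?_ (ENNReal.le_tsum n)
    apply ENNReal.ofReal_le_ofReal
    gcongr
    · norm_num
    · have : σ * 2 ^ n ≤ 1 := by rw [← hinv]; gcongr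
      rw [pow_succ]; linarith
  have hs : (2 : ℝ)⁻¹ ^ |α| * (2 : ℝ) ^ (-α * n) ≤ σ ^ α := by
    have e : σ = 2 ^ n * σ * (2 : ℝ)⁻¹ ^ n := by linear_combination (-σ) * hinv
    have s1 : (2 : ℝ)⁻¹ ≤ 2 ^ n * σ := by
      have : 2 ^ n * (2 : ℝ)⁻¹ ^ (n + 1) ≤ 2 ^ n * σ := by gcongr
      rw [pow_succ] at this; linear_combination this - 2⁻¹ * hinv
    have s2 : 2 ^ n * σ ≤ 1 := by rw [← hinv, mul_comm]; gcongr
    have e2 : (2 : ℝ) ^ (-α * n) = ((2 : ℝ)⁻¹ ^ n) ^ α := by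
      rw [inv_pow, ← Real.rpow_natCast, ← Real.rpow_neg (by norm_num),
        ← Real.rpow_mul (by norm_num)]
      congr 1; ring
    rw [e2]
    rw [show σ ^ α = (2 ^ n * σ) ^ α * ((2 : ℝ)⁻¹ ^ n) ^ α by
      rw [← Real.mul_rpow (by positivity) (by positivity), ← e]]
    gcongr
    calc (2 : ℝ)⁻¹ ^ |α| ≤ (2 ^ n * σ) ^ |α| := by gcongr
      _ ≤ _ := Real.rpow_le_rpow_of_exponent_ge (by positivity) s2 (le_abs_self α)
  have hσ1 : σ ≤ 1 := h2.trans (pow_le_one₀ (by norm_num) (by norm_num))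
  have hq2 : (‖a n‖ ^ 2 * (2 : ℝ) ^ (-2 : ℝ)) ^ (q / 2)
      = ‖a n‖ ^ q * ((2 : ℝ) ^ (-2 : ℝ)) ^ (q / 2) := by
    rw [Real.mul_rpow (by positivity) (by positivity), ← Real.rpow_natCast ‖a n‖ 2,
      ← Real.rpow_mul (norm_nonneg _)]
    congr 2; push_cast; ring
  refine le_trans ?_ (mul_le_mul_left hF _)
  rw [← ENNReal.ofReal_mul (by positivity), hq2]
  apply ENNReal.ofReal_le_ofReal
  have he : Real.exp (-2) ≤ Real.exp (-2 * σ) := Real.exp_le_exp.2 (by linarith)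
  calc _ = ‖a n‖ ^ q * ((2 : ℝ) ^ (-2 : ℝ)) ^ (q / 2) *
        (D * ((2 : ℝ)⁻¹ ^ |α| * (2 : ℝ) ^ (-α * n)) * Real.exp (-2)) := by ring
    _ ≤ _ := by gcongr

/-- The lacunary Dirichlet series `f(s) = ∑ a_n 2^{-2^n s}` satisfies
`∫_0^∞ (∑ |a_n|² 2^{-2^{n+1}σ})^{q/2} dμ_α(σ) < ∞` iff `∑ 2^{-(α+1)n} |a_n|^q < ∞`. -/
theorem lacunary_membership (q α : ℝ) (hq : 0 < q) (hα : -1 < α) (a : ℕ → ℂ) :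
    (∫⁻ σ in Set.Ioi (0 : ℝ),
        (∑' n : ℕ, ENNReal.ofReal (‖a n‖ ^ 2 * (2 : ℝ) ^ (-((2 : ℝ) ^ (n + 1)) * σ))) ^ (q / 2) *
          ENNReal.ofReal ((2 ^ (α + 1) / Real.Gamma (α + 1)) * σ ^ α * Real.exp (-2 * σ))) < ⊤ ↔
    (∑' n : ℕ, ENNReal.ofReal ((2 : ℝ) ^ (-(α + 1) * n) * ‖a n‖ ^ q)) < ⊤ := by
  constructor
  · intro h
    obtain ⟨c, hc, hl⟩ := lac_lower q α hq hα a
    set Φ : ℝ → ℝ≥0∞ := fun σ =>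
      (∑' n : ℕ, ENNReal.ofReal (‖a n‖ ^ 2 * (2 : ℝ) ^ (-((2 : ℝ) ^ (n + 1)) * σ))) ^ (q / 2) *
          ENNReal.ofReal ((2 ^ (α + 1) / Real.Gamma (α + 1)) * σ ^ α * Real.exp (-2 * σ)) with hΦ
    have hanti : Antitone (fun n : ℕ => (2 : ℝ)⁻¹ ^ n) :=
      pow_right_anti₀ (by norm_num) (by norm_num)
    have hdisj : Pairwise (Function.onFun Disjoint fun n : ℕ =>
        Set.Ioc ((2 : ℝ)⁻¹ ^ (n + 1)) ((2 : ℝ)⁻¹ ^ n)) := hanti.pairwise_disjoint_on_Ioc_succ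
    have h1 : ∑' n : ℕ, ∫⁻ σ in Set.Ioc ((2 : ℝ)⁻¹ ^ (n + 1)) ((2 : ℝ)⁻¹ ^ n), Φ σ < ⊤ := by
      rw [← lintegral_iUnion (fun _ => measurableSet_Ioc) hdisj]
      refine lt_of_le_of_lt (lintegral_mono_set ?_) h
      intro x hx
      obtain ⟨n, hn⟩ := Set.mem_iUnion.1 hx
      exact lt_trans (by positivity) hn.1
    have h2 : ENNReal.ofReal (c / 2) *
        ∑' n : ℕ, ENNReal.ofReal ((2 : ℝ) ^ (-(α + 1) * n) * ‖a n‖ ^ q) < ⊤ := by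
      refine lt_of_le_of_lt ?_ h1
      rw [← ENNReal.tsum_mul_left]
      refine ENNReal.tsum_le_tsum fun n => ?_
      have h3 := setLIntegral_mono' (μ := volume) measurableSet_Ioc (hl n)
      refine le_trans (le_of_eq ?_) h3
      rw [setLIntegral_const, Real.volume_Ioc, ← ENNReal.ofReal_mul (by positivity),
        ← ENNReal.ofReal_mul (by positivity)]
      congr 1
      have e2 : (2 : ℝ) ^ (-(α + 1) * n) = (2 : ℝ) ^ (-α * n) * (2 : ℝ)⁻¹ ^ n := by
        rw [inv_pow, ← Real.rpow_natCast, ← Real.rpow_neg (by norm_num),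
          ← Real.rpow_add (by norm_num)]
        congr 1; ring
      rw [e2, pow_succ]; ring
    by_contra h4
    rw [not_lt, top_le_iff] at h4
    rw [h4, ENNReal.mul_top (by simpa using hc)] at h2
    exact lt_irrefl _ h2
  · intro h
    have hα1 : 0 < (α + 1) / 2 := by linarith
    have hlog : 0 < Real.log 2 := Real.log_pos (by norm_num)
    obtain ⟨C, hC, hb⟩ := lac_pointwise q α hq hα a
    refine lt_of_le_of_lt (setLIntegral_mono' measurableSet_Ioi hb) ?_
    rw [lintegral_tsum (fun n => by fun_prop)]
    have hΓ : 0 < Real.Gamma ((α + 1) / 2) := Real.Gamma_pos_of_pos hα1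
    have : ∀ n : ℕ, (∫⁻ σ in Set.Ioi (0 : ℝ),
        ENNReal.ofReal (C * (‖a n‖ ^ q * (2 : ℝ) ^ (-((α + 1) / 2) * n))) *
        ENNReal.ofReal (σ ^ ((α + 1) / 2 - 1) *
        Real.exp (-((q / 2 * Real.log 2 * 2 ^ n) * σ)))) =
        ENNReal.ofReal (C * ((1 / (q / 2 * Real.log 2)) ^ ((α + 1) / 2) *
          Real.Gamma ((α + 1) / 2))) *
        ENNReal.ofReal ((2 : ℝ) ^ (-(α + 1) * n) * ‖a n‖ ^ q) := by
      intro n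
      rw [lintegral_const_mul' _ _ ENNReal.ofReal_ne_top, lac_gamma_lintegral _ _ hα1 (by positivity),
        ← ENNReal.ofReal_mul (by positivity), ← ENNReal.ofReal_mul (by positivity)]
      congr 1
      have e1 : 1 / (q / 2 * Real.log 2 * 2 ^ n) = 1 / (q / 2 * Real.log 2) * (2 : ℝ) ^ (-(n : ℝ)) := by
        rw [Real.rpow_neg (by norm_num), Real.rpow_natCast]; field_simp
      have e2 : (2 : ℝ) ^ (-(α + 1) * n) =
          (2 : ℝ) ^ (-((α + 1) / 2) * n) * (2 : ℝ) ^ (-(n : ℝ) * ((α + 1) / 2)) := by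
        rw [← Real.rpow_add (by norm_num)]; congr 1; ring
      rw [e1, Real.mul_rpow (by positivity) (by positivity), ← Real.rpow_mul (by norm_num), e2]
      ring
    simp_rw [this]
    rw [ENNReal.tsum_mul_left]
    exact ENNReal.mul_lt_top ENNReal.ofReal_lt_top h
end
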